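/- arXiv:0811.4203 — 2 statements merged into one kernel-verified Lean document; each statement's English description precedes it below -/
import Mathlib

section
/- Let (λ_m)_{m≥0} be a real sequence with λ_{m−1} = λ_m·(5 − λ_m) for all m ≥ 1, such that λ_m ∉ {2, 5} for all m and 5^m·λ_m converges as m → ∞. Then for γ_0 = (4, 4 − λ_0, 4 − λ_0)^T, lim_{k→∞} A_0^{−k} · A_0(λ_k)·A_0(λ_{k−1})⋯A_0(λ_1) · γ_0 = (4, 4, 4)^T. -/
open Matrix Filter Topology

/-- The harmonic extension matrix `A₀` of the Sierpinski gasket. -/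
noncomputable def A0 : Matrix (Fin 3) (Fin 3) ℝ :=
  (1/5 : ℝ) • !![5, 0, 0; 2, 2, 1; 2, 1, 2]

/-- The eigenfunction extension matrix `A₀(μ)` of spectral decimation. -/
noncomputable def A0l (m : ℝ) : Matrix (Fin 3) (Fin 3) ℝ :=
  (1/((5 - m) * (2 - m))) •
    !![(5 - m) * (2 - m), 0, 0; 4 - m, 4 - m, 2; 4 - m, 2, 4 - m]

/-- The product `A₀(λ_k)·A₀(λ_{k−1})⋯A₀(λ_1)`. -/
noncomputable def prodA (lam : ℕ → ℝ) : ℕ → Matrix (Fin 3) (Fin 3) ℝ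
  | 0 => 1
  | k + 1 => A0l (lam (k + 1)) * prodA lam k

theorem A0_mulVec_eigen (x : ℝ) :
    A0 *ᵥ ![4, 4 - 5 / 3 * x, 4 - 5 / 3 * x] = ![4, 4 - x, 4 - x] := by
  ext i
  fin_cases i <;> simp [A0, vecHead, vecTail] <;> ring

theorem isUnit_det_A0 : IsUnit A0.det := by
  rw [isUnit_iff_ne_zero, A0, det_smul]
  simp [det_fin_three]
  norm_num

theorem inv_A0_mulVec (x : ℝ) :
    A0⁻¹ *ᵥ ![4, 4 - x, 4 - x] = ![4, 4 - 5 / 3 * x, 4 - 5 / 3 * x] := by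
  rw [← A0_mulVec_eigen, mulVec_mulVec, nonsing_inv_mul _ isUnit_det_A0, one_mulVec]

theorem inv_A0_pow_mulVec (k : ℕ) (x : ℝ) :
    (A0⁻¹ ^ k) *ᵥ ![4, 4 - x, 4 - x] = ![4, 4 - (5 / 3) ^ k * x, 4 - (5 / 3) ^ k * x] := by
  induction k generalizing x with
  | zero => simp
  | succ k ih =>
    rw [pow_succ, ← mulVec_mulVec, inv_A0_mulVec, ih, pow_succ, mul_assoc]

/-- The extension matrix `A₀(μ)` maps `(4, 4 - μ(5 - μ), 4 - μ(5 - μ))` to `(4, 4 - μ, 4 - μ)`. -/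
theorem A0l_mulVec {m : ℝ} (h2 : m ≠ 2) (h5 : m ≠ 5) :
    A0l m *ᵥ ![4, 4 - m * (5 - m), 4 - m * (5 - m)] = ![4, 4 - m, 4 - m] := by
  have h2' : 2 - m ≠ 0 := sub_ne_zero.mpr h2.symm
  have h5' : 5 - m ≠ 0 := sub_ne_zero.mpr h5.symm
  ext i
  fin_cases i <;> simp [A0l, vecHead, vecTail] <;> field_simp <;> ring

theorem prodA_mulVec {lam : ℕ → ℝ}
    (hrec : ∀ m : ℕ, lam m = lam (m + 1) * (5 - lam (m + 1)))
    (h25 : ∀ m : ℕ, lam m ≠ 2 ∧ lam m ≠ 5) (k : ℕ) :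
    prodA lam k *ᵥ ![4, 4 - lam 0, 4 - lam 0] = ![4, 4 - lam k, 4 - lam k] := by
  induction k with
  | zero => simp [prodA]
  | succ k ih =>
    rw [prodA, ← mulVec_mulVec, ih, hrec k, A0l_mulVec (h25 _).1 (h25 _).2]

theorem sg_spectral_decimation_limit_gamma
    (lam : ℕ → ℝ)
    (hrec : ∀ m : ℕ, lam m = lam (m + 1) * (5 - lam (m + 1)))
    (h25 : ∀ m : ℕ, lam m ≠ 2 ∧ lam m ≠ 5)
    (hconv : ∃ L : ℝ, Tendsto (fun m : ℕ => (5 : ℝ) ^ m * lam m) atTop (𝓝 L)) :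
    Tendsto
      (fun k : ℕ => (A0⁻¹ ^ k * prodA lam k).mulVec ![4, 4 - lam 0, 4 - lam 0]) atTop
      (𝓝 ![4, 4, 4]) := by
  obtain ⟨L, hL⟩ := hconv
  have hzero : Tendsto (fun k : ℕ => (5 / 3 : ℝ) ^ k * lam k) atTop (𝓝 0) := by
    have hgeom : Tendsto (fun k : ℕ => (1 / 3 : ℝ) ^ k) atTop (𝓝 0) :=
      tendsto_pow_atTop_nhds_zero_of_lt_one (by norm_num) (by norm_num)
    have hmul := hgeom.mul hL
    rw [zero_mul] at hmul
    refine hmul.congr fun k => ?_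
    rw [← mul_assoc, ← mul_pow]
    norm_num
  have hsub : Tendsto (fun k : ℕ => 4 - (5 / 3 : ℝ) ^ k * lam k) atTop (𝓝 4) := by
    simpa using hzero.const_sub 4
  simp only [← mulVec_mulVec, prodA_mulVec hrec h25, inv_A0_pow_mulVec]
  rw [tendsto_pi_nhds]
  intro i
  fin_cases i
  · exact tendsto_const_nhds
  · exact hsub
  · exact hsub
end

section
/- Let (λ_m)_{m≥0} be a real sequence with λ_{m−1} = λ_m·(5 − λ_m) for all m ≥ 1, such that λ_m ∉ {2, 5} for all m, λ_0 ≠ 0, and (3/2)·5^m·λ_m converges to a limit λ as m → ∞. Then lim_{m→∞} (2,−1,−1) · A_0^{−m} · A_0(λ_m)·A_0(λ_{m−1})⋯A_0(λ_1) · (0,1,0)^T = −(4λ/(3·λ_0·(2 − λ_1))) · ∏_{j=2}^∞ (1 − λ_j/3). (This is the normal derivative at q_0 of the λ-eigenfunction on the Sierpinski gasket with boundary values (0,1,0).) -/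
open Matrix Filter Topology

theorem vecMul_A0_inv :
    ![2, -1, -1] ᵥ* A0⁻¹ = (5 / 3 : ℝ) • ![2, -1, -1] := by
  have h : ![2, -1, -1] ᵥ* A0 = (3 / 5 : ℝ) • ![2, -1, -1] := by
    ext i
    fin_cases i <;> simp [A0, vecMul, dotProduct, Fin.sum_univ_three] <;> norm_num
  calc ![2, -1, -1] ᵥ* A0⁻¹
      = (5 / 3 : ℝ) • (((3 / 5 : ℝ) • ![2, -1, -1]) ᵥ* A0⁻¹) := by
        rw [smul_vecMul, smul_smul]; norm_num
    _ = (5 / 3 : ℝ) • ![2, -1, -1] := by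
        rw [← h, vecMul_vecMul, mul_nonsing_inv _ isUnit_det_A0, vecMul_one]

theorem vecMul_A0_inv_pow (m : ℕ) :
    ![2, -1, -1] ᵥ* A0⁻¹ ^ m = (5 / 3 : ℝ) ^ m • ![2, -1, -1] := by
  induction m with
  | zero => simp
  | succ k ih => rw [pow_succ, ← vecMul_vecMul, ih, smul_vecMul, vecMul_A0_inv, smul_smul, pow_succ]

theorem A0l_mulVec_zero (μ : ℝ) (v : Fin 3 → ℝ) (hv : v 0 = 0) : (A0l μ *ᵥ v) 0 = 0 := by
  simp [A0l, mulVec, dotProduct, Fin.sum_univ_three, hv]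

theorem dotProduct_A0l_mulVec (μ : ℝ) (v : Fin 3 → ℝ) (hv : v 0 = 0) :
    ![2, -1, -1] ⬝ᵥ (A0l μ *ᵥ v) = (6 - μ) / ((5 - μ) * (2 - μ)) * (![2, -1, -1] ⬝ᵥ v) := by
  simp [A0l, mulVec, dotProduct, Fin.sum_univ_three, hv, div_eq_mul_inv]
  ring

theorem prodA_mulVec_zero (lam : ℕ → ℝ) (v : Fin 3 → ℝ) (hv : v 0 = 0) (m : ℕ) :
    (prodA lam m *ᵥ v) 0 = 0 := by
  induction m with
  | zero => simpa [prodA] using hv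
  | succ k ih => rw [prodA, ← mulVec_mulVec]; exact A0l_mulVec_zero _ _ ih

/-- The identity `6 - λₘ = (2 - λₘ₊₁)(3 - λₘ₊₁)` makes the product of the factors
`(6 - λⱼ) / ((5 - λⱼ)(2 - λⱼ))` telescope. -/
theorem dotProduct_prodA_mulVec (lam : ℕ → ℝ)
    (hrec : ∀ m : ℕ, lam m = lam (m + 1) * (5 - lam (m + 1)))
    (h2 : ∀ m : ℕ, lam m ≠ 2) (h0 : ∀ m : ℕ, lam m ≠ 0)
    (v : Fin 3 → ℝ) (hv : v 0 = 0) (m : ℕ) :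
    ![2, -1, -1] ⬝ᵥ (prodA lam m *ᵥ v) =
      3 ^ m * lam m * (2 - lam (m + 1)) / (lam 0 * (2 - lam 1)) *
        (∏ j ∈ Finset.range m, (1 - lam (j + 2) / 3)) * (![2, -1, -1] ⬝ᵥ v) := by
  have hne (k : ℕ) : 2 - lam k ≠ 0 := sub_ne_zero.mpr (h2 k).symm
  induction m with
  | zero =>
    have := h0 0
    have := hne 1
    simp only [prodA, one_mulVec, pow_zero, Finset.range_zero, Finset.prod_empty, zero_add]
    field_simp
  | succ k ih =>
    rw [prodA, ← mulVec_mulVec, dotProduct_A0l_mulVec _ _ (prodA_mulVec_zero lam v hv k), ih,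
      Finset.prod_range_succ]
    have hk : 5 - lam (k + 1) ≠ 0 := fun h ↦ h0 k (by rw [hrec k, h, mul_zero])
    have hsix : 6 - lam (k + 1) = (2 - lam (k + 2)) * (3 - lam (k + 2)) := by
      rw [hrec (k + 1)]; ring
    have := h0 0
    have := hne 1
    have := hne (k + 1)
    rw [hsix, hrec k]
    field_simp
    ring

theorem summable_of_tendsto_pow_mul {r : ℝ} (hr : 1 < r) {f : ℕ → ℝ} {L : ℝ}
    (h : Tendsto (fun m : ℕ => r ^ m * f m) atTop (𝓝 L)) : Summable f := by
  have hr0 : 0 < r := one_pos.trans hr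
  refine summable_of_isBigO_nat
    (summable_geometric_of_lt_one (inv_nonneg.mpr hr0.le) (inv_lt_one_of_one_lt₀ hr)) ?_
  have := (h.isBigO_one ℝ).mul (Asymptotics.isBigO_refl (fun m : ℕ => r⁻¹ ^ m) atTop)
  refine this.congr (fun m => ?_) (fun m => one_mul _)
  rw [mul_right_comm, ← mul_pow, mul_inv_cancel₀ hr0.ne', one_pow, one_mul]

/-- The normal derivative at `q₀` of the `λ`-eigenfunction on the Sierpinski gasket
with boundary values `(0,1,0)`. -/
theorem sg_normal_derivative_at_zero
    (lam : ℕ → ℝ) (L : ℝ)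
    (hrec : ∀ m : ℕ, lam m = lam (m + 1) * (5 - lam (m + 1)))
    (h25 : ∀ m : ℕ, lam m ≠ 2 ∧ lam m ≠ 5)
    (h0 : lam 0 ≠ 0)
    (hlim : Tendsto (fun m : ℕ => (3/2 : ℝ) * 5 ^ m * lam m) atTop (𝓝 L)) :
    ∃ p : ℝ,
      Tendsto (fun n : ℕ => ∏ j ∈ Finset.Icc 2 n, (1 - lam j / 3)) atTop (𝓝 p) ∧
      Tendsto
        (fun m : ℕ => ![2, -1, -1] ⬝ᵥ (A0⁻¹ ^ m * prodA lam m).mulVec ![0, 1, 0]) atTop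
        (𝓝 (-(4 * L / (3 * lam 0 * (2 - lam 1))) * p)) := by
  have hne (m : ℕ) : lam m ≠ 0 := by
    induction m with
    | zero => exact h0
    | succ k ih => exact left_ne_zero_of_mul (hrec k ▸ ih)
  have hlim' : Tendsto (fun m : ℕ => 5 ^ m * lam m) atTop (𝓝 (2 / 3 * L)) :=
    (hlim.const_mul (2 / 3)).congr fun m => by ring
  have hsum : Summable lam := summable_of_tendsto_pow_mul (by norm_num) hlim'
  have hmul : Multipliable fun j : ℕ => 1 - lam (j + 2) / 3 := by
    simpa only [sub_eq_add_neg] using Real.multipliable_one_add_of_summable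
      ((summable_nat_add_iff 2).mpr hsum |>.div_const 3 |>.neg)
  have hprod := hmul.hasProd.tendsto_prod_nat
  refine ⟨_, (tendsto_add_atTop_iff_nat 1).mp (hprod.congr fun n => ?_), ?_⟩
  · rw [← Finset.Ico_add_one_right_eq_Icc, Finset.prod_Ico_eq_prod_range]
    exact Finset.prod_congr (by simp) fun j _ => by rw [add_comm]
  have hshift : Tendsto (fun m : ℕ => 2 - lam (m + 1)) atTop (𝓝 (2 - 0)) :=
    ((tendsto_add_atTop_iff_nat 1).mpr hsum.tendsto_atTop_zero).const_sub 2
  have key := (((hlim'.mul hshift).div_const (lam 0 * (2 - lam 1))).mul hprod).neg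
  convert key using 2 with m
  · rw [← mulVec_mulVec, dotProduct_mulVec, vecMul_A0_inv_pow, smul_dotProduct,
      dotProduct_prodA_mulVec lam hrec (fun m => (h25 m).1) hne _ (by simp)]
    have h53 : (5 / 3 : ℝ) ^ m * 3 ^ m = 5 ^ m := by rw [← mul_pow]; norm_num
    rw [← h53]
    simp [dotProduct, Fin.sum_univ_three]
    ring
  · have : 2 - lam 1 ≠ 0 := sub_ne_zero.mpr (h25 1).1.symm
    field_simp
    ring
end
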